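/- arXiv:2508.04341 — 4 statements merged into one kernel-verified Lean document; each statement's English description precedes it below -/
import Mathlib

section
/- Let n ≥ 1, let V : ℝ^{2n} × [0,T] → ℝ and W : ℝ^{2n} × ℝ^{2n} × [0,T] → ℝ be C² functions, let κ ∈ ℝ, let μ : [s₁,s₂] × [0,T] → ℝ be continuous, and let Z = (P,X) : [s₁,s₂] × [0,T] → ℝⁿ × ℝⁿ be a C² map which is a closed curve for every time, i.e. Z(s₁,t) = Z(s₂,t) for all t ∈ [0,T]. Suppose Z satisfies the zeroth-order Hamilton–Ehrenfest equation ∂ₜZ(s,t) = J∇_zV(Z(s,t),t) + κ ∫_{s₁}^{s₂} μ(r,t) · J∇_zW(Z(s,t), Z(r,t), t) dr, where ∇_z denotes the gradient with respect to the first 2n arguments. Then the loop action F(t) = ∫_{s₁}^{s₂} ⟨P(s,t), ∂ₛX(s,t)⟩ ds is constant in t on [0,T]. -/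
open scoped RealInnerProductSpace

section

open Set MeasureTheory Topology

/-- Differentiation under the integral sign, for a `C¹` integrand with an integrable weight. -/
theorem hasDerivAt_intervalIntegral_mul_of_contDiff {a b : ℝ} {m : ℝ → ℝ}
    (hm : IntervalIntegrable m volume a b) {G G' : ℝ → ℝ → ℝ}
    (hG : Continuous (fun q : ℝ × ℝ => G q.1 q.2))
    (hG' : Continuous (fun q : ℝ × ℝ => G' q.1 q.2))
    (hd : ∀ x r, HasDerivAt (fun y => G y r) (G' x r) x) (x : ℝ) :
    HasDerivAt (fun y => ∫ r in a..b, m r * G y r) (∫ r in a..b, m r * G' x r) x := by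
  obtain ⟨C, hC⟩ := ((isCompact_Icc (a := x - 1) (b := x + 1)).prod
    (isCompact_uIcc (a := a) (b := b))).exists_bound_of_continuousOn hG'.continuousOn
  have hint : ∀ {H : ℝ → ℝ → ℝ}, Continuous (fun q : ℝ × ℝ => H q.1 q.2) → ∀ y,
      IntervalIntegrable (fun r => m r * H y r) volume a b := fun {H} hH y =>
    hm.mul_continuousOn (hH.comp (by fun_prop : Continuous fun r : ℝ => (y, r))).continuousOn
  refine (intervalIntegral.hasDerivAt_integral_of_dominated_loc_of_deriv_le
    (F := fun y r => m r * G y r) (F' := fun y r => m r * G' y r)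
    (s := Icc (x - 1) (x + 1)) (bound := fun r => ‖m r‖ * C)
    (Icc_mem_nhds (by linarith) (by linarith))
    (Filter.Eventually.of_forall fun y => (hint hG y).aestronglyMeasurable_restrict_uIoc)
    (hint hG x) (hint hG' x).aestronglyMeasurable_restrict_uIoc ?_ (hm.norm.mul_const C) ?_).2
  · refine Filter.Eventually.of_forall fun r hr y hy => ?_
    rw [norm_mul]
    gcongr
    exact hC (y, r) ⟨hy, uIoc_subset_uIcc hr⟩
  · exact Filter.Eventually.of_forall fun r _ y _ => (hd y r).const_mul _

variable {F : Type*} [NormedAddCommGroup F] [NormedSpace ℝ F]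

theorem hasDerivAt_fst_of_contDiff {f : ℝ → ℝ → F}
    (hf : ContDiff ℝ 1 (fun q : ℝ × ℝ => f q.1 q.2)) (s t : ℝ) :
    HasDerivAt (fun s' => f s' t) (fderiv ℝ (fun q : ℝ × ℝ => f q.1 q.2) (s, t) (1, 0)) s :=
  (hf.differentiable one_ne_zero (s, t)).hasFDerivAt.comp_hasDerivAt s
    (f := fun s' => (s', t)) ((hasDerivAt_id s).prodMk (hasDerivAt_const s t))

theorem hasDerivAt_snd_of_contDiff {f : ℝ → ℝ → F}
    (hf : ContDiff ℝ 1 (fun q : ℝ × ℝ => f q.1 q.2)) (s t : ℝ) :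
    HasDerivAt (fun t' => f s t') (fderiv ℝ (fun q : ℝ × ℝ => f q.1 q.2) (s, t) (0, 1)) t :=
  (hf.differentiable one_ne_zero (s, t)).hasFDerivAt.comp_hasDerivAt t
    (f := fun t' => (s, t')) ((hasDerivAt_const t s).prodMk (hasDerivAt_id t))

/-- Two maps agreeing on `[0, T]` have the same derivative there. -/
theorem HasDerivAt.eq_of_eqOn_Icc {T : ℝ} {f g : ℝ → F} {f' g' : F}
    {t : ℝ} (hf : HasDerivAt f f' t) (hg : HasDerivAt g g' t) (h : EqOn f g (Icc 0 T))
    (ht : t ∈ Ico 0 T) : f' = g' :=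
  (uniqueDiffOn_Icc (ht.1.trans_lt ht.2) t (Ico_subset_Icc_self ht)).eq_deriv _
    hf.hasDerivWithinAt (hg.hasDerivWithinAt.congr h (h (Ico_subset_Icc_self ht)))

variable {E : Type*} [NormedAddCommGroup E] [InnerProductSpace ℝ E] [CompleteSpace E]

/-- The chain rule along a curve `(p, x)` in terms of the two partial gradients. -/
theorem hasDerivAt_comp_prodMk_gradient {f : E → E → ℝ}
    (hf : Differentiable ℝ (fun z : E × E => f z.1 z.2)) {p x : ℝ → E} {p' x' : E} {s : ℝ}
    (hp : HasDerivAt p p' s) (hx : HasDerivAt x x' s) :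
    HasDerivAt (fun y => f (p y) (x y))
      (⟪gradient (fun q => f q (x s)) (p s), p'⟫ + ⟪gradient (fun q => f (p s) q) (x s), x'⟫)
      s := by
  have h := (hf (p s, x s)).hasFDerivAt
  have h₁ : HasFDerivAt (fun q => f q (x s)) _ (p s) :=
    h.comp (p s) (f := fun q => (q, x s)) (hasFDerivAt_prodMk_left (p s) (x s))
  have h₂ : HasFDerivAt (fun q => f (p s) q) _ (x s) :=
    h.comp (x s) (f := fun q => (p s, q)) (hasFDerivAt_prodMk_right (p s) (x s))
  convert! h.comp_hasDerivAt s (hp.prodMk hx) using 1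
  rw [← InnerProductSpace.toDual_apply_apply (𝕜 := ℝ),
    ← InnerProductSpace.toDual_apply_apply (𝕜 := ℝ), toDual_gradient, toDual_gradient,
    h₁.fderiv, h₂.fderiv]
  simp [← map_add]

/-- The partial gradient of a `C¹` family of functions is continuous in the parameters. -/
theorem continuous_gradient_of_contDiff {f : F → E → ℝ}
    (hf : ContDiff ℝ 1 (fun q : F × E => f q.1 q.2)) {g : F → E} (hg : Continuous g) :
    Continuous fun r => gradient (f r) (g r) :=
  (InnerProductSpace.toDual ℝ E).symm.continuous.comp
    (Continuous.fderiv_one hf hg)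

theorem intervalIntegral_inner_const {a b : ℝ} {f : ℝ → E}
    (hf : IntervalIntegrable f volume a b) (v : E) :
    ∫ r in a..b, ⟪f r, v⟫ = ⟪∫ r in a..b, f r, v⟫ := by
  simp only [real_inner_comm v]
  exact (innerSL ℝ v).intervalIntegral_comp_comm hf

/-- Along a curve the Hamiltonian `v + κ ∫ m(r) w(·, ·, r) dr` varies at the rate given by the
pairing of its gradients with the velocity. -/
theorem hasDerivAt_meanField_hamiltonian {a b κ : ℝ} {m : ℝ → ℝ}
    (hm : IntervalIntegrable m volume a b) {v : E → E → ℝ} {w : E → E → ℝ → ℝ}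
    (hv : ContDiff ℝ 1 (fun z : E × E => v z.1 z.2))
    (hw : ContDiff ℝ 1 (fun q : (E × E) × ℝ => w q.1.1 q.1.2 q.2))
    {p x : ℝ → E} (hp : ContDiff ℝ 1 p) (hx : ContDiff ℝ 1 x) (s : ℝ) :
    HasDerivAt (fun y => v (p y) (x y) + κ * ∫ r in a..b, m r * w (p y) (x y) r)
      (⟪gradient (fun q => v q (x s)) (p s) +
          κ • ∫ r in a..b, m r • gradient (fun q => w q (x s) r) (p s), deriv p s⟫ +
        ⟪gradient (fun q => v (p s) q) (x s) +
          κ • ∫ r in a..b, m r • gradient (fun q => w (p s) q r) (x s), deriv x s⟫) s := by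
  have hp' := fun y => (hp.differentiable one_ne_zero y).hasDerivAt
  have hx' := fun y => (hx.differentiable one_ne_zero y).hasDerivAt
  have hcp : Continuous (deriv p) := hp.continuous_deriv le_rfl
  have hcx : Continuous (deriv x) := hx.continuous_deriv le_rfl
  have hw₁ : Continuous fun q : ℝ × ℝ =>
      gradient (fun q' => w q' (x q.1) q.2) (p q.1) :=
    continuous_gradient_of_contDiff (F := ℝ × ℝ) (f := fun q q' => w q' (x q.1) q.2)
      (hw.comp (f := fun q : (ℝ × ℝ) × E => ((q.2, x q.1.1), q.1.2)) (by fun_prop))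
      (by fun_prop)
  have hw₂ : Continuous fun q : ℝ × ℝ =>
      gradient (fun q' => w (p q.1) q' q.2) (x q.1) :=
    continuous_gradient_of_contDiff (F := ℝ × ℝ) (f := fun q q' => w (p q.1) q' q.2)
      (hw.comp (f := fun q : (ℝ × ℝ) × E => ((p q.1.1, q.2), q.1.2)) (by fun_prop))
      (by fun_prop)
  have hsr : Continuous fun r : ℝ => (s, r) := by fun_prop
  have hi₁ : IntervalIntegrable
      (fun r => m r • gradient (fun q => w q (x s) r) (p s)) volume a b :=
    hm.smul_continuousOn (hw₁.comp hsr).continuousOn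
  have hi₂ : IntervalIntegrable
      (fun r => m r • gradient (fun q => w (p s) q r) (x s)) volume a b :=
    hm.smul_continuousOn (hw₂.comp hsr).continuousOn
  have hW := hasDerivAt_intervalIntegral_mul_of_contDiff hm
    (G := fun y r => w (p y) (x y) r)
    (G' := fun y r => ⟪gradient (fun q => w q (x y) r) (p y), deriv p y⟫ +
      ⟪gradient (fun q => w (p y) q r) (x y), deriv x y⟫)
    (hw.continuous.comp (by fun_prop : Continuous fun q : ℝ × ℝ => ((p q.1, x q.1), q.2)))
    ((hw₁.inner (by fun_prop)).add (hw₂.inner (by fun_prop)))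
    (fun y r => hasDerivAt_comp_prodMk_gradient (f := fun q q' => w q q' r)
      ((hw.comp (f := fun z : E × E => (z, r)) (by fun_prop)).differentiable one_ne_zero)
      (hp' y) (hx' y)) s
  have hV := hasDerivAt_comp_prodMk_gradient (hv.differentiable one_ne_zero) (hp' s) (hx' s)
  convert! hV.add (hW.const_mul κ) using 1
  have hsplit : (∫ r in a..b, m r * (⟪gradient (fun q => w q (x s) r) (p s), deriv p s⟫ +
      ⟪gradient (fun q => w (p s) q r) (x s), deriv x s⟫)) =
      ⟪∫ r in a..b, m r • gradient (fun q => w q (x s) r) (p s), deriv p s⟫ +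
      ⟪∫ r in a..b, m r • gradient (fun q => w (p s) q r) (x s), deriv x s⟫ := by
    rw [← intervalIntegral_inner_const hi₁, ← intervalIntegral_inner_const hi₂]
    simp only [real_inner_smul_left, mul_add]
    exact intervalIntegral.integral_add
      (hm.mul_continuousOn ((hw₁.comp hsr).inner continuous_const).continuousOn)
      (hm.mul_continuousOn ((hw₂.comp hsr).inner continuous_const).continuousOn)
  rw [hsplit]
  simp only [inner_add_left, real_inner_smul_left]
  ring

end

/-- Let `n ≥ 1`, let `V(z,t)` and `W(z,w,t)` (with phase-space
points `z = (p,x)`, `w = (p',x') ∈ ℝⁿ × ℝⁿ`) be `C²`, let `κ ∈ ℝ`, let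
`μ : [s₁,s₂] × [0,T] → ℝ` be continuous, and let `Z = (P, X)` be a `C²` map
which is a closed curve for every time (`Z(s₁,t) = Z(s₂,t)`) and satisfies the
zeroth-order Hamilton–Ehrenfest equations
`∂ₜZ(s,t) = J∇_zV(Z(s,t),t) + κ ∫_{s₁}^{s₂} μ(r,t) J∇_zW(Z(s,t),Z(r,t),t) dr`,
written componentwise as `∂ₜP = -∇ₓV - κ∫μ∇ₓW` and `∂ₜX = ∇ₚV + κ∫μ∇ₚW`.
Then the loop action `F t = ∫_{s₁}^{s₂} ⟪P s t, ∂ₛX s t⟫ ds` is constant in `t`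
on `[0,T]`. -/
theorem loop_action_constant_hamilton_ehrenfest (n : ℕ) (hn : 1 ≤ n)
    (T s₁ s₂ : ℝ) (hT : 0 ≤ T) (hs : s₁ ≤ s₂) (κ : ℝ)
    (V : EuclideanSpace ℝ (Fin n) → EuclideanSpace ℝ (Fin n) → ℝ → ℝ)
    (W : EuclideanSpace ℝ (Fin n) → EuclideanSpace ℝ (Fin n) →
      EuclideanSpace ℝ (Fin n) → EuclideanSpace ℝ (Fin n) → ℝ → ℝ)
    (hV : ContDiff ℝ 2
      (fun q : (EuclideanSpace ℝ (Fin n) × EuclideanSpace ℝ (Fin n)) × ℝ =>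
        V q.1.1 q.1.2 q.2))
    (hW : ContDiff ℝ 2
      (fun q : ((EuclideanSpace ℝ (Fin n) × EuclideanSpace ℝ (Fin n)) ×
          (EuclideanSpace ℝ (Fin n) × EuclideanSpace ℝ (Fin n))) × ℝ =>
        W q.1.1.1 q.1.1.2 q.1.2.1 q.1.2.2 q.2))
    (μ : ℝ → ℝ → ℝ)
    (hμ : ContinuousOn (fun q : ℝ × ℝ => μ q.1 q.2)
      (Set.Icc s₁ s₂ ×ˢ Set.Icc (0 : ℝ) T))
    (P X : ℝ → ℝ → EuclideanSpace ℝ (Fin n))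
    (hZ : ContDiff ℝ 2 (fun q : ℝ × ℝ => (P q.1 q.2, X q.1 q.2)))
    (hclosed : ∀ t ∈ Set.Icc (0 : ℝ) T, P s₁ t = P s₂ t ∧ X s₁ t = X s₂ t)
    (heqP : ∀ s ∈ Set.Icc s₁ s₂, ∀ t ∈ Set.Icc (0 : ℝ) T,
      deriv (fun t' => P s t') t =
        -gradient (fun x => V (P s t) x t) (X s t) -
          κ • ∫ r in s₁..s₂,
            μ r t • gradient (fun x => W (P s t) x (P r t) (X r t) t) (X s t))
    (heqX : ∀ s ∈ Set.Icc s₁ s₂, ∀ t ∈ Set.Icc (0 : ℝ) T,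
      deriv (fun t' => X s t') t =
        gradient (fun p => V p (X s t) t) (P s t) +
          κ • ∫ r in s₁..s₂,
            μ r t • gradient (fun p => W p (X s t) (P r t) (X r t) t) (P s t)) :
    ∀ t ∈ Set.Icc (0 : ℝ) T, ∀ t' ∈ Set.Icc (0 : ℝ) T,
      (∫ s in s₁..s₂, ⟪P s t, deriv (fun s' => X s' t) s⟫) =
        ∫ s in s₁..s₂, ⟪P s t', deriv (fun s' => X s' t') s⟫ := by
  set Pu : ℝ × ℝ → EuclideanSpace ℝ (Fin n) := fun q => P q.1 q.2
  set Xu : ℝ × ℝ → EuclideanSpace ℝ (Fin n) := fun q => X q.1 q.2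
  have hP2 : ContDiff ℝ 2 Pu := contDiff_fst.comp hZ
  have hX2 : ContDiff ℝ 2 Xu := contDiff_snd.comp hZ
  have hP1 : ContDiff ℝ 1 Pu := hP2.of_le one_le_two
  have hX1 : ContDiff ℝ 1 Xu := hX2.of_le one_le_two
  have hdX : ContDiff ℝ 1 (fderiv ℝ Xu) := hX2.fderiv_right (by norm_num)
  have hdP : Continuous (fderiv ℝ Pu) := hP1.continuous_fderiv one_ne_zero
  have hddX : Continuous (fderiv ℝ (fderiv ℝ Xu)) := hdX.continuous_fderiv one_ne_zero
  have hXs1 : ContDiff ℝ 1 (fun q : ℝ × ℝ => fderiv ℝ Xu (q.1, q.2) (1, 0)) :=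
    hdX.clm_apply contDiff_const
  have hXt1 : ContDiff ℝ 1 (fun q : ℝ × ℝ => fderiv ℝ Xu (q.1, q.2) (0, 1)) :=
    hdX.clm_apply contDiff_const
  have hPs := hasDerivAt_fst_of_contDiff (f := P) hP1
  have hPt := hasDerivAt_snd_of_contDiff (f := P) hP1
  have hXs := hasDerivAt_fst_of_contDiff (f := X) hX1
  have hXt := hasDerivAt_snd_of_contDiff (f := X) hX1
  have hXst : ∀ s t, HasDerivAt (fun t' => fderiv ℝ Xu (s, t') (1, 0))
      (fderiv ℝ (fderiv ℝ Xu) (s, t) (0, 1) (1, 0)) t := fun s t => by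
    have := ((hdX.differentiable one_ne_zero (s, t)).hasFDerivAt.comp_hasDerivAt t
      (f := fun t' => (s, t')) ((hasDerivAt_const t s).prodMk (hasDerivAt_id t))).clm_apply
      (hasDerivAt_const t ((1, 0) : ℝ × ℝ))
    simpa using this
  have hXts : ∀ s t, HasDerivAt (fun s' => fderiv ℝ Xu (s', t) (0, 1))
      (fderiv ℝ (fderiv ℝ Xu) (s, t) (0, 1) (1, 0)) s := fun s t => by
    have := ((hdX.differentiable one_ne_zero (s, t)).hasFDerivAt.comp_hasDerivAt s
      (f := fun s' => (s', t)) ((hasDerivAt_id s).prodMk (hasDerivAt_const s t))).clm_apply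
      (hasDerivAt_const s ((0, 1) : ℝ × ℝ))
    rw [← (hX2.contDiffAt.isSymmSndFDerivAt (by simp)) (1, 0) (0, 1)]
    simpa using this
  simp only [(hXs _ _).deriv]
  set A' : ℝ → ℝ → ℝ := fun t s => ⟪P s t, fderiv ℝ (fderiv ℝ Xu) (s, t) (0, 1) (1, 0)⟫ +
    ⟪fderiv ℝ Pu (s, t) (0, 1), fderiv ℝ Xu (s, t) (1, 0)⟫
  have hA'c : Continuous fun q : ℝ × ℝ => A' q.1 q.2 := by
    have h := hP1.continuous
    have hX' := hdX.continuous
    have hsw : Continuous fun q : ℝ × ℝ => (q.2, q.1) := by fun_prop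
    exact ((h.comp hsw).inner ((((hddX.comp hsw).clm_apply continuous_const).clm_apply
      continuous_const))).add (((hdP.comp hsw).clm_apply continuous_const).inner
      ((hX'.comp hsw).clm_apply continuous_const))
  have hF : ∀ t, HasDerivAt (fun t' => ∫ s in s₁..s₂, ⟪P s t', fderiv ℝ Xu (s, t') (1, 0)⟫)
      (∫ s in s₁..s₂, A' t s) t := fun t => by
    have := hasDerivAt_intervalIntegral_mul_of_contDiff (a := s₁) (b := s₂) (m := fun _ => 1)
      intervalIntegrable_const (G := fun t s => ⟪P s t, fderiv ℝ Xu (s, t) (1, 0)⟫) (G' := A')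
      ((hP1.inner ℝ hXs1).continuous.comp (by fun_prop : Continuous fun q : ℝ × ℝ => (q.2, q.1)))
      hA'c (fun t s => (hPt s t).inner ℝ (hXst s t)) t
    simpa only [one_mul] using this
  have hzero : ∀ t ∈ Set.Ico (0 : ℝ) T, ∫ s in s₁..s₂, A' t s = 0 := fun t ht => by
    have ht' := Set.Ico_subset_Icc_self ht
    have hm : IntervalIntegrable (fun r => μ r t) MeasureTheory.volume s₁ s₂ := by
      refine ContinuousOn.intervalIntegrable_of_Icc hs ?_
      exact hμ.comp (f := fun r => (r, t)) (by fun_prop) fun r hr => ⟨hr, ht'⟩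
    have hpt : ContDiff ℝ 1 fun s => P s t :=
      hP1.comp (f := fun s : ℝ => (s, t)) (by fun_prop)
    have hxt : ContDiff ℝ 1 fun s => X s t :=
      hX1.comp (f := fun s : ℝ => (s, t)) (by fun_prop)
    have hΦ := hasDerivAt_meanField_hamiltonian (κ := κ) hm (v := fun p x => V p x t)
      (w := fun p x r => W p x (P r t) (X r t) t)
      ((hV.of_le one_le_two).comp
        (f := fun z : EuclideanSpace ℝ (Fin n) × EuclideanSpace ℝ (Fin n) => (z, t))
        (by fun_prop))
      ((hW.of_le one_le_two).comp
        (f := fun q : (EuclideanSpace ℝ (Fin n) × EuclideanSpace ℝ (Fin n)) × ℝ =>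
          ((q.1, (P q.2 t, X q.2 t)), t)) (by fun_prop)) hpt hxt
    have hd : ∀ s ∈ Set.uIcc s₁ s₂, HasDerivAt (fun s => ⟪P s t, fderiv ℝ Xu (s, t) (0, 1)⟫ -
        (V (P s t) (X s t) t +
          κ * ∫ r in s₁..s₂, μ r t * W (P s t) (X s t) (P r t) (X r t) t)) (A' t s) s := by
      intro s hs'
      rw [Set.uIcc_of_le hs] at hs'
      convert! ((hPs s t).inner ℝ (hXts s t)).sub (hΦ s) using 1
      rw [← heqX s hs' t ht', (hXt s t).deriv, (hPs s t).deriv, (hXs s t).deriv]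
      have hp := heqP s hs' t ht'
      rw [(hPt s t).deriv, sub_eq_add_neg, ← neg_add] at hp
      rw [eq_neg_iff_add_eq_zero.mpr (by rw [hp]; abel :
        gradient (fun q => V (P s t) q t) (X s t) + κ • (∫ r in s₁..s₂, μ r t •
          gradient (fun q => W (P s t) q (P r t) (X r t) t) (X s t)) +
          fderiv ℝ Pu (s, t) (0, 1) = 0), inner_neg_left,
        real_inner_comm (fderiv ℝ Pu (s, t) (1, 0))]
      ring
    rw [intervalIntegral.integral_eq_sub_of_hasDerivAt hd
      ((hA'c.comp (by fun_prop : Continuous fun s : ℝ => (t, s))).intervalIntegrable _ _)]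
    rw [(hclosed t ht').1, (hclosed t ht').2,
      (hXt s₁ t).eq_of_eqOn_Icc (hXt s₂ t) (fun t' h => (hclosed t' h).2) ht, sub_self]
  have hconst := constant_of_has_deriv_right_zero (a := 0) (b := T)
    (fun t _ => (hF t).continuousAt.continuousWithinAt)
    fun t ht => hzero t ht ▸ (hF t).hasDerivWithinAt
  exact fun t ht t' ht' => (hconst t ht).trans (hconst t' ht').symm
end

section
/- Let n ≥ 1, let a, b ∈ ℝⁿ, and let k ∈ {1,…,n} with the k-th component a_k ≠ 0. Let φ : ℝⁿ → ℂ be differentiable and define ψ : ℝⁿ → ℂ by ψ(χ) = exp(−i(2a_kχ_k⟨b,χ⟩ − χ_k²⟨a,b⟩)/(2a_k²)) · φ(χ). Then φ satisfies the transport equation D_aφ(χ) = i⟨b,χ⟩ φ(χ) for all χ ∈ ℝⁿ if and only if D_aψ(χ) = 0 for all χ ∈ ℝⁿ, where D_a denotes the directional derivative along a. -/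
open scoped RealInnerProductSpace

/-- The derivative of the quadratic phase along `a` is `⟪b, χ⟫`, up to the factor `2 * a k ^ 2`. -/
lemma hasDerivAt_phase_line {n : ℕ} (a b χ : EuclideanSpace ℝ (Fin n)) (k : Fin n) :
    HasDerivAt (fun t : ℝ => 2 * a k * (χ + t • a) k * ⟪b, χ + t • a⟫
      - (χ + t • a) k ^ 2 * ⟪a, b⟫) (2 * a k ^ 2 * ⟪b, χ⟫) 0 := by
  have hk : HasDerivAt (fun t : ℝ => χ k + t * a k) (a k) 0 := by
    simpa using ((hasDerivAt_id (0 : ℝ)).mul_const (a k)).const_add (χ k)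
  have hb : HasDerivAt (fun t : ℝ => ⟪b, χ⟫ + t * ⟪b, a⟫) ⟪b, a⟫ 0 := by
    simpa using ((hasDerivAt_id (0 : ℝ)).mul_const ⟪b, a⟫).const_add ⟪b, χ⟫
  simp only [PiLp.add_apply, PiLp.smul_apply, smul_eq_mul, inner_add_right, inner_smul_right]
  refine (((hk.const_mul (2 * a k)).mul hb).sub ((hk.pow 2).mul_const ⟪a, b⟫)).congr_deriv ?_
  rw [real_inner_comm a b]
  simp
  ring

/-- A Fréchet derivative applied to `a` is the derivative along the line through `χ`. -/
lemma DifferentiableAt.hasDerivAt_line {E F : Type*} [NormedAddCommGroup E] [NormedSpace ℝ E]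
    [NormedAddCommGroup F] [NormedSpace ℝ F] {f : E → F} {χ : E}
    (hf : DifferentiableAt ℝ f χ) (a : E) :
    HasDerivAt (fun t : ℝ => f (χ + t • a)) (fderiv ℝ f χ a) 0 :=
  hf.hasFDerivAt.hasLineDerivAt a

/-- (Coordinate form of the transport-equation solution.)
Let `n ≥ 1`, `a, b ∈ ℝⁿ`, `k ∈ {1,…,n}` with `a_k ≠ 0`, and let `φ : ℝⁿ → ℂ`
be differentiable.  Put
`ψ χ = exp(-i(2a_k χ_k ⟪b,χ⟫ - χ_k² ⟪a,b⟫)/(2a_k²)) · φ χ`.  Then `φ`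
satisfies the transport equation `D_a φ(χ) = i⟪b,χ⟫ φ(χ)` for all `χ` if and
only if `D_a ψ(χ) = 0` for all `χ` (with `D_a f(χ) = fderiv ℝ f χ a`). -/
theorem transport_equation_coordinate_form (n : ℕ) (hn : 1 ≤ n)
    (a b : EuclideanSpace ℝ (Fin n)) (k : Fin n) (hak : a k ≠ 0)
    (φ : EuclideanSpace ℝ (Fin n) → ℂ) (hφ : Differentiable ℝ φ) :
    (∀ χ, fderiv ℝ φ χ a = Complex.I * (⟪b, χ⟫ : ℂ) * φ χ) ↔
    (∀ χ, fderiv ℝ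
        (fun χ' : EuclideanSpace ℝ (Fin n) =>
          Complex.exp (-(Complex.I *
              ((2 * a k * χ' k * ⟪b, χ'⟫ - χ' k ^ 2 * ⟪a, b⟫ : ℝ) : ℂ)) /
            (2 * ((a k : ℝ) : ℂ) ^ 2)) * φ χ') χ a = 0) := by
  have hak' : ((a k : ℝ) : ℂ) ≠ 0 := by exact_mod_cast hak
  refine forall_congr' fun χ => ?_
  have hφ' := (hφ χ).hasDerivAt_line a
  have hexp := (((hasDerivAt_phase_line a b χ k).ofReal_comp.const_mul Complex.I).neg.div_const
    (2 * ((a k : ℝ) : ℂ) ^ 2)).cexp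
  have hψ : DifferentiableAt ℝ (fun χ' : EuclideanSpace ℝ (Fin n) =>
      Complex.exp (-(Complex.I *
          ((2 * a k * χ' k * ⟪b, χ'⟫ - χ' k ^ 2 * ⟪a, b⟫ : ℝ) : ℂ)) /
        (2 * ((a k : ℝ) : ℂ) ^ 2)) * φ χ') χ := by
    have hq : DifferentiableAt ℝ (fun χ' : EuclideanSpace ℝ (Fin n) =>
        2 * a k * χ' k * ⟪b, χ'⟫ - χ' k ^ 2 * ⟪a, b⟫) χ := by
      have hc : DifferentiableAt ℝ (fun χ' : EuclideanSpace ℝ (Fin n) => χ' k) χ :=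
        (EuclideanSpace.proj (𝕜 := ℝ) k).differentiableAt
      have hb : DifferentiableAt ℝ (fun χ' : EuclideanSpace ℝ (Fin n) => ⟪b, χ'⟫) χ :=
        (innerSL ℝ b).differentiableAt
      fun_prop
    have hqc := Complex.ofRealCLM.differentiableAt.comp χ hq
    exact (((hqc.const_mul Complex.I).neg.mul_const _).cexp).mul (hφ χ)
  rw [(hψ.hasDerivAt_line a).unique (hexp.mul hφ')]
  have hcancel : -(Complex.I * ((2 * a k ^ 2 * ⟪b, χ⟫ : ℝ) : ℂ)) / (2 * ((a k : ℝ) : ℂ) ^ 2)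
      = -(Complex.I * (⟪b, χ⟫ : ℂ)) := by
    push_cast
    field_simp
  rw [hcancel, zero_smul, add_zero, mul_assoc (Complex.exp _), ← mul_add, mul_eq_zero,
    or_iff_right (Complex.exp_ne_zero _), neg_mul, neg_add_eq_zero, eq_comm]
end

section
/- Let n ≥ 1, ℏ > 0, let P, X, P', X' ∈ ℝⁿ and S ∈ ℝ, and let φ : ℝⁿ → ℂ be differentiable. Define Φ : ℝⁿ → ℂ by Φ(x) = φ((x−X)/√ℏ) · exp((i/ℏ)(S + ⟨P, x−X⟩)). Then the identity ⟨P', x−X⟩ Φ(x) − ⟨X', (−iℏ∇ − P)Φ(x)⟩ = 0 holds for all x ∈ ℝⁿ (where (−iℏ∇ − P)Φ denotes the vector-valued function with j-th component −iℏ∂_{x_j}Φ − P_jΦ) if and only if φ satisfies the transport equation D_{X'}φ(χ) = i⟨P',χ⟩ φ(χ) for all χ ∈ ℝⁿ. -/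
open scoped RealInnerProductSpace

section SemiclassicalAnsatz

variable {E : Type*} [NormedAddCommGroup E] [InnerProductSpace ℝ E]

/-- The derivative of the semiclassical ansatz along a direction `v`. -/
lemma fderiv_semiclassical_ansatz_apply (ε : ℝ) (c s : ℂ) (P X : E) {φ : E → ℂ}
    (hφ : Differentiable ℝ φ) (x v : E) :
    fderiv ℝ (fun y => φ (ε • (y - X)) * Complex.exp (c * (s + ((⟪P, y - X⟫ : ℝ) : ℂ)))) x v =
      ((ε : ℂ) * fderiv ℝ φ (ε • (x - X)) v + c * ((⟪P, v⟫ : ℝ) : ℂ) * φ (ε • (x - X))) *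
        Complex.exp (c * (s + ((⟪P, x - X⟫ : ℝ) : ℂ))) := by
  have hprofile : HasFDerivAt (fun y => φ (ε • (y - X)))
      ((fderiv ℝ φ (ε • (x - X))).comp (ε • ContinuousLinearMap.id ℝ E)) x :=
    (hφ _).hasFDerivAt.comp x (((hasFDerivAt_id x).sub_const X).const_smul ε)
  have hinner : HasFDerivAt (fun y => ((⟪P, y - X⟫ : ℝ) : ℂ))
      (Complex.ofRealCLM.comp (innerSL ℝ P)) x :=
    (Complex.ofRealCLM.comp (innerSL ℝ P)).hasFDerivAt.comp x
      ((hasFDerivAt_id x).sub_const X)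
  have hphase := ((hinner.const_add s).const_mul c).cexp
  rw [(hprofile.fun_mul hphase).fderiv]
  simp
  ring

end SemiclassicalAnsatz

/-- The value of a continuous linear map at `v` is the combination of its values on the standard
basis with the coordinates of `v` as coefficients. -/
lemma EuclideanSpace.sum_coord_mul_apply_single {n : ℕ}
    (L : EuclideanSpace ℝ (Fin n) →L[ℝ] ℂ) (v : EuclideanSpace ℝ (Fin n)) :
    ∑ j, ((v j : ℝ) : ℂ) * L (EuclideanSpace.single j 1) = L v := by
  conv_rhs => rw [← (EuclideanSpace.basisFun (Fin n) ℝ).sum_repr v]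
  simp

/-- Let `n ≥ 1`, `ℏ > 0`, `P, X, P', X' ∈ ℝⁿ`, `S ∈ ℝ`, and
let `φ : ℝⁿ → ℂ` be differentiable.  Define the semiclassical ansatz
`Φ x = φ((x-X)/√ℏ) · exp((i/ℏ)(S + ⟪P, x-X⟫))`.  Then the constraint
`⟪P', x-X⟫ Φ x - ⟨X', (-iℏ∇ - P)Φ(x)⟩ = 0` holds for all `x` (the `j`-th
component of `(-iℏ∇ - P)Φ` being `-iℏ ∂_{x_j}Φ - P_j Φ`) if and only if `φ`
satisfies the transport equation `D_{X'} φ(χ) = i⟪P',χ⟫ φ(χ)` for all `χ`. -/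
theorem semiclassical_ansatz_constraint_iff_transport (n : ℕ) (hn : 1 ≤ n)
    (ℏ : ℝ) (hℏ : 0 < ℏ)
    (P X P' X' : EuclideanSpace ℝ (Fin n)) (S : ℝ)
    (φ : EuclideanSpace ℝ (Fin n) → ℂ) (hφ : Differentiable ℝ φ)
    (Φ : EuclideanSpace ℝ (Fin n) → ℂ)
    (hΦ : ∀ x, Φ x =
      φ ((Real.sqrt ℏ)⁻¹ • (x - X)) *
        Complex.exp ((Complex.I / ℏ) * ((S : ℂ) + ((⟪P, x - X⟫ : ℝ) : ℂ)))) :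
    (∀ x, ((⟪P', x - X⟫ : ℝ) : ℂ) * Φ x -
        ∑ j : Fin n, ((X' j : ℝ) : ℂ) *
          (-(Complex.I * ℏ) * fderiv ℝ Φ x (EuclideanSpace.single j 1) -
            ((P j : ℝ) : ℂ) * Φ x) = 0) ↔
    (∀ χ, fderiv ℝ φ χ X' = Complex.I * ((⟪P', χ⟫ : ℝ) : ℂ) * φ χ) := by
  have hΦ' := funext hΦ
  have hsqrt : (Real.sqrt ℏ : ℂ) ≠ 0 := by
    exact_mod_cast (Real.sqrt_pos.mpr hℏ).ne'
  have hsq : (Real.sqrt ℏ : ℂ) ^ 2 = ℏ := by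
    exact_mod_cast Real.sq_sqrt hℏ.le
  have hsum : ∀ x, ∑ j : Fin n, ((X' j : ℝ) : ℂ) *
      (-(Complex.I * ℏ) * fderiv ℝ Φ x (EuclideanSpace.single j 1) - ((P j : ℝ) : ℂ) * Φ x) =
      -(Complex.I * ℏ) * fderiv ℝ Φ x X' - ((⟪P, X'⟫ : ℝ) : ℂ) * Φ x := by
    intro x
    rw [← EuclideanSpace.sum_coord_mul_apply_single (fderiv ℝ Φ x) X', PiLp.inner_apply]
    push_cast
    rw [Finset.mul_sum, Finset.sum_mul, ← Finset.sum_sub_distrib]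
    refine Finset.sum_congr rfl fun j _ => ?_
    simp only [RCLike.inner_apply, conj_trivial]
    push_cast
    ring
  have hconstraint : ∀ χ, ((⟪P', Real.sqrt ℏ • χ⟫ : ℝ) : ℂ) * Φ (X + Real.sqrt ℏ • χ) -
      (-(Complex.I * ℏ) * fderiv ℝ Φ (X + Real.sqrt ℏ • χ) X' -
        ((⟪P, X'⟫ : ℝ) : ℂ) * Φ (X + Real.sqrt ℏ • χ)) =
      Complex.I * Real.sqrt ℏ *
        Complex.exp ((Complex.I / ℏ) * ((S : ℂ) + ((⟪P, Real.sqrt ℏ • χ⟫ : ℝ) : ℂ))) *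
        (fderiv ℝ φ χ X' - Complex.I * ((⟪P', χ⟫ : ℝ) : ℂ) * φ χ) := by
    intro χ
    have hχ : (Real.sqrt ℏ)⁻¹ • Real.sqrt ℏ • χ = χ :=
      inv_smul_smul₀ (Real.sqrt_pos.mpr hℏ).ne' χ
    rw [hΦ', fderiv_semiclassical_ansatz_apply _ _ _ _ _ hφ]
    simp only [add_sub_cancel_left, hχ]
    generalize Complex.exp _ = e
    rw [inner_smul_right]
    push_cast
    rw [← hsq]
    field_simp
    linear_combination (Real.sqrt ℏ * e * ((⟪P', χ⟫ : ℝ) : ℂ) * φ χ +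
      e * ((⟪P, X'⟫ : ℝ) : ℂ) * φ χ) * Complex.I_sq
  simp only [hsum]
  have hpoint : ∀ χ, ((⟪P', Real.sqrt ℏ • χ⟫ : ℝ) : ℂ) * Φ (X + Real.sqrt ℏ • χ) -
      (-(Complex.I * ℏ) * fderiv ℝ Φ (X + Real.sqrt ℏ • χ) X' -
        ((⟪P, X'⟫ : ℝ) : ℂ) * Φ (X + Real.sqrt ℏ • χ)) = 0 ↔
      fderiv ℝ φ χ X' = Complex.I * ((⟪P', χ⟫ : ℝ) : ℂ) * φ χ := by
    intro χ
    rw [hconstraint, mul_eq_zero, sub_eq_zero, or_iff_right]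
    exact mul_ne_zero (mul_ne_zero Complex.I_ne_zero hsqrt) (Complex.exp_ne_zero _)
  constructor
  · intro h χ
    rw [← hpoint]
    simpa only [add_sub_cancel_left] using h (X + Real.sqrt ℏ • χ)
  · intro h x
    have hx : Real.sqrt ℏ • (Real.sqrt ℏ)⁻¹ • (x - X) = x - X :=
      smul_inv_smul₀ (Real.sqrt_pos.mpr hℏ).ne' _
    simpa only [hx, add_sub_cancel] using (hpoint ((Real.sqrt ℏ)⁻¹ • (x - X))).mpr (h _)
end

section
/- Let n ≥ 1, let X : ℝ × ℝ → ℝⁿ be C², and let τ : ℝⁿ × ℝ → ℝ be differentiable at a point (x₀,t₀) and satisfy, for all (x,t) in a neighborhood of (x₀,t₀), the hypersurface equation ⟨∂ₛX(τ(x,t),t), x − X(τ(x,t),t)⟩ = 0. Set s₀ = τ(x₀,t₀) and suppose D := |∂ₛX(s₀,t₀)|² − ⟨∂ₛₛX(s₀,t₀), x₀ − X(s₀,t₀)⟩ ≠ 0. Then the spatial gradient of τ at (x₀,t₀) equals ∇ₓτ(x₀,t₀) = ∂ₛX(s₀,t₀) / D. -/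
open scoped RealInnerProductSpace

/-- Implicit differentiation of the orthogonality condition `⟪c' (g r), y r - c (g r)⟫ = 0`. -/
theorem deriv_mul_eq_inner_of_eventually_orthogonal {E : Type*} [NormedAddCommGroup E]
    [InnerProductSpace ℝ E] {c : ℝ → E} (hc : ContDiff ℝ 2 c) {g : ℝ → ℝ} {g' r : ℝ}
    (hg : HasDerivAt g g' r) {y : ℝ → E} {v : E} (hy : HasDerivAt y v r)
    (horth : ∀ᶠ u in nhds r, ⟪deriv c (g u), y u - c (g u)⟫ = 0) :
    g' * (‖deriv c (g r)‖ ^ 2 - ⟪deriv (deriv c) (g r), y r - c (g r)⟫) = ⟪deriv c (g r), v⟫ := by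
  have hc₁ : HasDerivAt c (deriv c (g r)) (g r) :=
    (hc.differentiable (by norm_num) _).hasDerivAt
  have hc₂ : HasDerivAt (deriv c) (deriv (deriv c) (g r)) (g r) :=
    ((hc.deriv' (n := 1)).differentiable (by norm_num) _).hasDerivAt
  have h := (hc₂.scomp r hg).inner ℝ (hy.sub (hc₁.scomp r hg))
  have h₀ := h.unique ((hasDerivAt_const r (0 : ℝ)).congr_of_eventuallyEq horth)
  simp only [Function.comp_apply, Pi.sub_apply, inner_sub_right, inner_smul_left, inner_smul_right,
    real_inner_self_eq_norm_sq, RCLike.conj_to_real] at h₀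
  rw [inner_sub_right]
  linarith

/-- Let `n ≥ 1`, let `X : ℝ × ℝ → ℝⁿ` be `C²` (as a function
of `(s,t)`), and let `τ : ℝⁿ × ℝ → ℝ` be differentiable at `(x₀,t₀)` and
satisfy the hypersurface equation
`⟪∂ₛX(τ(x,t),t), x - X(τ(x,t),t)⟫ = 0` for all `(x,t)` near `(x₀,t₀)`.
With `s₀ = τ(x₀,t₀)` and `D = ‖∂ₛX(s₀,t₀)‖² - ⟪∂ₛₛX(s₀,t₀), x₀ - X(s₀,t₀)⟫ ≠ 0`,
the spatial gradient of `τ` at `(x₀,t₀)` is `∂ₛX(s₀,t₀)/D`, i.e. the spatial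
directional derivative along any `v` equals `⟪D⁻¹ • ∂ₛX(s₀,t₀), v⟫`. -/
theorem hypersurface_parameter_spatial_gradient (n : ℕ) (hn : 1 ≤ n)
    (X : ℝ → ℝ → EuclideanSpace ℝ (Fin n))
    (hX : ContDiff ℝ 2 (fun q : ℝ × ℝ => X q.1 q.2))
    (τ : EuclideanSpace ℝ (Fin n) × ℝ → ℝ)
    (x₀ : EuclideanSpace ℝ (Fin n)) (t₀ : ℝ)
    (hτ : DifferentiableAt ℝ τ (x₀, t₀))
    (horth : ∀ᶠ q : EuclideanSpace ℝ (Fin n) × ℝ in nhds (x₀, t₀),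
      ⟪deriv (fun s => X s q.2) (τ q), q.1 - X (τ q) q.2⟫ = 0)
    (D : ℝ)
    (hD : D = ‖deriv (fun s => X s t₀) (τ (x₀, t₀))‖ ^ 2 -
      ⟪deriv (deriv (fun s => X s t₀)) (τ (x₀, t₀)), x₀ - X (τ (x₀, t₀)) t₀⟫)
    (hD0 : D ≠ 0) :
    ∀ v : EuclideanSpace ℝ (Fin n),
      fderiv ℝ τ (x₀, t₀) (v, 0) =
        ⟪D⁻¹ • deriv (fun s => X s t₀) (τ (x₀, t₀)), v⟫ := by
  intro v
  have hy : HasDerivAt (fun r : ℝ => x₀ + r • v) v 0 := by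
    simpa using ((hasDerivAt_id (0 : ℝ)).smul_const v).const_add x₀
  have hline : HasDerivAt (fun r : ℝ => (x₀ + r • v, t₀)) (v, 0) 0 :=
    hy.prodMk (hasDerivAt_const 0 t₀)
  have hbase : (x₀ + (0 : ℝ) • v, t₀) = (x₀, t₀) := by simp
  have hg : HasDerivAt (fun r : ℝ => τ (x₀ + r • v, t₀)) (fderiv ℝ τ (x₀, t₀) (v, 0)) 0 :=
    hτ.hasFDerivAt.comp_hasDerivAt_of_eq 0 hline hbase.symm
  have hc : ContDiff ℝ 2 (fun s => X s t₀) := hX.comp (contDiff_id.prodMk contDiff_const)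
  have horth₀ : ∀ᶠ r : ℝ in nhds 0, ⟪deriv (fun s => X s t₀) (τ (x₀ + r • v, t₀)),
      x₀ + r • v - X (τ (x₀ + r • v, t₀)) t₀⟫ = 0 :=
    (hbase ▸ hline.continuousAt.tendsto).eventually horth
  have h := deriv_mul_eq_inner_of_eventually_orthogonal hc hg hy horth₀
  simp only [zero_smul, add_zero] at h
  rw [← hD] at h
  rw [real_inner_smul_left, ← h]
  field_simp
end
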